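/- arXiv:math/0502119 — 2 statements merged into one kernel-verified Lean document; each statement's English description precedes it below -/
import Mathlib

section
/- Let p : k[S_n] → k[S_n] be the projection onto the center defined by p(x) = (1/n!) Σ_{s∈S_n} s x s⁻¹. Then p maps g_n into itself, its image p(g_n) equals k·T_n, and the derived subalgebra g'_n equals the kernel of the restriction of p to g_n. -/
open MonoidAlgebra in
/-- The set of transpositions `(i j)` inside the group algebra `k[S_n]`. -/
def transpositions (k : Type) [Field k] (n : ℕ) : Set (MonoidAlgebra k (Equiv.Perm (Fin n))) :=
  {x | ∃ i j : Fin n, i ≠ j ∧ x = MonoidAlgebra.of k (Equiv.Perm (Fin n)) (Equiv.swap i j)}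

attribute [local instance 100] LieRing.ofAssociativeRing

/-- `g_n`: the Lie subalgebra of the group algebra `k[S_n]` (with the commutator
bracket `⁅a, b⁆ = a * b - b * a`) generated by the transpositions. -/
noncomputable def gn (k : Type) [Field k] (n : ℕ) : LieSubalgebra k (MonoidAlgebra k (Equiv.Perm (Fin n))) :=
  LieSubalgebra.lieSpan k (MonoidAlgebra k (Equiv.Perm (Fin n))) (transpositions k n)

/-- `g'_n = [g_n, g_n]`: the derived subalgebra of `g_n`, the span of all brackets
of elements of `g_n`. -/
noncomputable def gnDer (k : Type) [Field k] (n : ℕ) : Submodule k (MonoidAlgebra k (Equiv.Perm (Fin n))) :=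
  Submodule.span k {x | ∃ a ∈ gn k n, ∃ b ∈ gn k n, x = ⁅a, b⁆}

/-- `T_n`: the sum of all transpositions in `k[S_n]`. -/
noncomputable def sumTranspositions (k : Type) [Field k] (n : ℕ) :
    MonoidAlgebra k (Equiv.Perm (Fin n)) :=
  ∑ p ∈ Finset.univ.filter (fun p : Fin n × Fin n => p.1 < p.2),
    MonoidAlgebra.of k (Equiv.Perm (Fin n)) (Equiv.swap p.1 p.2)

section helpers

variable (k : Type) [Field k] (n : ℕ)

/-- The averaging projection as a linear map. -/
noncomputable def avg : MonoidAlgebra k (Equiv.Perm (Fin n)) →ₗ[k] MonoidAlgebra k (Equiv.Perm (Fin n)) :=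
  (n.factorial : k)⁻¹ • ∑ s : Equiv.Perm (Fin n),
    (LinearMap.mulLeft k (MonoidAlgebra.of k (Equiv.Perm (Fin n)) s)).comp
      (LinearMap.mulRight k (MonoidAlgebra.of k (Equiv.Perm (Fin n)) s⁻¹))

theorem avg_apply (x : MonoidAlgebra k (Equiv.Perm (Fin n))) :
    avg k n x = (n.factorial : k)⁻¹ •
      ∑ s : Equiv.Perm (Fin n),
        MonoidAlgebra.of k (Equiv.Perm (Fin n)) s * x *
          MonoidAlgebra.of k (Equiv.Perm (Fin n)) s⁻¹ := by
  simp only [avg, LinearMap.smul_apply, LinearMap.sum_apply, LinearMap.comp_apply,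
    LinearMap.mulLeft_apply, LinearMap.mulRight_apply, mul_assoc]

theorem avg_of (g : Equiv.Perm (Fin n)) :
    avg k n (MonoidAlgebra.of k _ g) = (n.factorial : k)⁻¹ •
      ∑ s : Equiv.Perm (Fin n), MonoidAlgebra.of k (Equiv.Perm (Fin n)) (s * g * s⁻¹) := by
  rw [avg_apply]; simp only [map_mul]

theorem avg_of_conj (g t : Equiv.Perm (Fin n)) :
    avg k n (MonoidAlgebra.of k _ (t * g * t⁻¹)) = avg k n (MonoidAlgebra.of k _ g) := by
  rw [avg_of, avg_of]
  congr 1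
  refine Fintype.sum_equiv (Equiv.mulRight t) _ _ fun s => ?_
  simp [mul_assoc]

theorem avg_mul_comm (a b : MonoidAlgebra k (Equiv.Perm (Fin n))) :
    avg k n (a * b) = avg k n (b * a) := by
  induction a using MonoidAlgebra.induction_on with
  | of g =>
    induction b using MonoidAlgebra.induction_on with
    | of h =>
      rw [← map_mul, ← map_mul, ← avg_of_conj k n (h * g) g]
      congr 2
      group
    | add x y hx hy => simp only [mul_add, add_mul, map_add, hx, hy]
    | smul r x hx => simp only [mul_smul_comm, smul_mul_assoc, map_smul, hx]
  | add x y hx hy => simp only [mul_add, add_mul, map_add, hx, hy]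
  | smul r x hx => simp only [mul_smul_comm, smul_mul_assoc, map_smul, hx]

theorem avg_lie (a b : MonoidAlgebra k (Equiv.Perm (Fin n))) : avg k n ⁅a, b⁆ = 0 := by
  rw [Ring.lie_def, map_sub, avg_mul_comm, sub_self]

theorem swap_mem_gn (i j : Fin n) (h : i ≠ j) :
    MonoidAlgebra.of k (Equiv.Perm (Fin n)) (Equiv.swap i j) ∈ gn k n :=
  LieSubalgebra.subset_lieSpan ⟨i, j, h, rfl⟩

theorem lie_mem_gnDer {a b : MonoidAlgebra k (Equiv.Perm (Fin n))} (ha : a ∈ gn k n)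
    (hb : b ∈ gn k n) : ⁅a, b⁆ ∈ gnDer k n :=
  Submodule.subset_span ⟨a, ha, b, hb, rfl⟩

theorem gnDer_le {x : MonoidAlgebra k (Equiv.Perm (Fin n))} (hx : x ∈ gnDer k n) :
    x ∈ gn k n ∧ avg k n x = 0 := by
  have h : gnDer k n ≤ (gn k n).toSubmodule ⊓ LinearMap.ker (avg k n) := by
    refine Submodule.span_le.2 ?_
    rintro _ ⟨a, ha, b, hb, rfl⟩
    exact ⟨(gn k n).lie_mem ha hb, avg_lie k n a b⟩
  exact h hx

theorem conj_swap (s : Equiv.Perm (Fin n)) (i j : Fin n) :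
    s * Equiv.swap i j * s⁻¹ = Equiv.swap (s i) (s j) := by
  rw [Equiv.mul_swap_eq_swap_mul, mul_inv_cancel_right]

theorem swap_conj_mem [CharZero k] (a b i j : Fin n) (hab : a ≠ b) (h : i ≠ j) :
    MonoidAlgebra.of k (Equiv.Perm (Fin n)) (Equiv.swap i j)
      - MonoidAlgebra.of k _ (Equiv.swap (Equiv.swap a b i) (Equiv.swap a b j)) ∈ gnDer k n := by
  have h1 := lie_mem_gnDer k n (swap_mem_gn k n a b hab)
    ((gn k n).lie_mem (swap_mem_gn k n a b hab) (swap_mem_gn k n i j h))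
  have h2 := (gnDer k n).smul_mem (2⁻¹ : k) h1
  convert h2 using 1
  rw [← conj_swap, Equiv.swap_inv, map_mul, map_mul, Ring.lie_def, Ring.lie_def]
  have hA : MonoidAlgebra.of k (Equiv.Perm (Fin n)) (Equiv.swap a b) *
    MonoidAlgebra.of k (Equiv.Perm (Fin n)) (Equiv.swap a b) = 1 := by
    rw [← map_mul, Equiv.swap_mul_self, map_one]
  generalize MonoidAlgebra.of k (Equiv.Perm (Fin n)) (Equiv.swap a b) = A at *
  generalize MonoidAlgebra.of k (Equiv.Perm (Fin n)) (Equiv.swap i j) = B at *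
  have e : A * (A * B - B * A) - (A * B - B * A) * A = (2 : k) • (B - A * B * A) := by
    have : A * (A * B - B * A) - (A * B - B * A) * A
      = (A * A) * B + B * (A * A) - A * B * A - A * B * A := by noncomm_ring
    rw [this, hA, two_smul]; noncomm_ring
  rw [e, smul_smul, inv_mul_cancel₀ two_ne_zero, one_smul]

theorem perm_conj_mem [CharZero k] (s : Equiv.Perm (Fin n)) : ∀ (i j : Fin n) (_ : i ≠ j),
    MonoidAlgebra.of k (Equiv.Perm (Fin n)) (Equiv.swap i j)
      - MonoidAlgebra.of k _ (Equiv.swap (s i) (s j)) ∈ gnDer k n := by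
  induction s using Equiv.Perm.swap_induction_on with
  | one => intro i j _; simp
  | swap_mul f x y hxy ih =>
    intro i j h
    have h1 := (gnDer k n).add_mem (ih i j h)
      (swap_conj_mem k n x y (f i) (f j) hxy (f.injective.ne h))
    simpa using h1

theorem avg_swap_sub [CharZero k] (i j : Fin n) (h : i ≠ j) :
    MonoidAlgebra.of k (Equiv.Perm (Fin n)) (Equiv.swap i j)
      - avg k n (MonoidAlgebra.of k _ (Equiv.swap i j)) ∈ gnDer k n := by
  have hf : (n.factorial : k) ≠ 0 := Nat.cast_ne_zero.2 n.factorial_ne_zero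
  have h1 := (gnDer k n).smul_mem (n.factorial : k)⁻¹
    ((gnDer k n).sum_mem (t := Finset.univ) fun s _ => perm_conj_mem k n s i j h)
  convert h1 using 1
  rw [avg_of, Finset.sum_sub_distrib, smul_sub]
  simp only [conj_swap]
  congr 1
  rw [Finset.sum_const, Finset.card_univ, Fintype.card_perm, Fintype.card_fin,
    ← Nat.cast_smul_eq_nsmul k, smul_smul, inv_mul_cancel₀ hf, one_smul]

theorem two_sum : (2 : k) • sumTranspositions k n =
    ∑ p ∈ Finset.univ.filter (fun p : Fin n × Fin n => p.1 ≠ p.2),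
    MonoidAlgebra.of k (Equiv.Perm (Fin n)) (Equiv.swap p.1 p.2) := by
  have h2 : sumTranspositions k n =
    ∑ p ∈ Finset.univ.filter (fun p : Fin n × Fin n => p.2 < p.1),
      MonoidAlgebra.of k (Equiv.Perm (Fin n)) (Equiv.swap p.1 p.2) := by
    refine Finset.sum_equiv (Equiv.prodComm _ _) ?_ ?_
    · simp
    · intro p _
      simp [Equiv.swap_comm]
  rw [two_smul]
  nth_rewrite 2 [h2]
  rw [sumTranspositions, ← Finset.sum_union]
  · refine Finset.sum_congr ?_ fun _ _ => rfl
    ext p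
    simp
  · rw [Finset.disjoint_filter]
    intro p _ h
    exact h.asymm

theorem avg_T [CharZero k] : avg k n (sumTranspositions k n) = sumTranspositions k n := by
  have hf : (n.factorial : k) ≠ 0 := Nat.cast_ne_zero.2 n.factorial_ne_zero
  have key : avg k n ((2 : k) • sumTranspositions k n) = (2 : k) • sumTranspositions k n := by
    rw [two_sum, map_sum]
    simp only [avg_of, conj_swap]
    rw [← Finset.smul_sum, Finset.sum_comm]
    have : ∀ s : Equiv.Perm (Fin n),
      ∑ p ∈ Finset.univ.filter (fun p : Fin n × Fin n => p.1 ≠ p.2),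
        MonoidAlgebra.of k (Equiv.Perm (Fin n)) (Equiv.swap (s p.1) (s p.2)) =
      ∑ p ∈ Finset.univ.filter (fun p : Fin n × Fin n => p.1 ≠ p.2),
        MonoidAlgebra.of k (Equiv.Perm (Fin n)) (Equiv.swap p.1 p.2) := by
      intro s
      refine Finset.sum_equiv (Equiv.prodCongr s s) ?_ ?_
      · simp
      · intro p _
        simp
    simp only [this]
    rw [Finset.sum_const, Finset.card_univ, Fintype.card_perm, Fintype.card_fin,
      ← Nat.cast_smul_eq_nsmul k, smul_smul, inv_mul_cancel₀ hf, one_smul]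
  rw [map_smul] at key
  exact smul_right_injective _ (two_ne_zero (α := k)) key

theorem avg_swap_eq (i j a b : Fin n) (h : i ≠ j) (hab : a ≠ b) :
    avg k n (MonoidAlgebra.of k _ (Equiv.swap a b)) =
      avg k n (MonoidAlgebra.of k _ (Equiv.swap i j)) := by
  obtain ⟨c, hc⟩ := isConj_iff.1 (Equiv.Perm.isConj_swap h hab)
  rw [← hc, avg_of_conj]

theorem avg_swap [CharZero k] (i j : Fin n) (h : i ≠ j) :
    ∃ c : k, avg k n (MonoidAlgebra.of k _ (Equiv.swap i j)) = c • sumTranspositions k n := by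
  have h1 := avg_T k n
  have h2 : avg k n (sumTranspositions k n) =
    ((Finset.univ.filter (fun p : Fin n × Fin n => p.1 < p.2)).card : k) •
      avg k n (MonoidAlgebra.of k _ (Equiv.swap i j)) := by
    rw [Nat.cast_smul_eq_nsmul, ← Finset.sum_const, sumTranspositions, map_sum]
    refine Finset.sum_congr rfl fun p hp => ?_
    exact avg_swap_eq k n i j p.1 p.2 h (Finset.mem_filter.1 hp).2.ne
  have hN : ((Finset.univ.filter (fun p : Fin n × Fin n => p.1 < p.2)).card : k) ≠ 0 := by
    rw [Nat.cast_ne_zero]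
    refine Finset.card_ne_zero.2 ?_
    rcases lt_or_gt_of_ne h with h | h
    · exact ⟨(i, j), by simpa using h⟩
    · exact ⟨(j, i), by simpa using h⟩
  refine ⟨_, (eq_inv_smul_iff₀ hN).2 ?_⟩
  rw [← h2, h1]

theorem T_mem : sumTranspositions k n ∈ gn k n := by
  refine (gn k n).toSubmodule.sum_mem fun p hp => ?_
  exact swap_mem_gn k n p.1 p.2 (Finset.mem_filter.1 hp).2.ne

theorem gn_main [CharZero k] {x : MonoidAlgebra k (Equiv.Perm (Fin n))} (hx : x ∈ gn k n) :
    x - avg k n x ∈ gnDer k n ∧ ∃ c : k, avg k n x = c • sumTranspositions k n := by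
  induction hx using LieSubalgebra.lieSpan_induction with
  | mem x h =>
    obtain ⟨i, j, hij, rfl⟩ := h
    exact ⟨avg_swap_sub k n i j hij, avg_swap k n i j hij⟩
  | zero => exact ⟨by simp, 0, by simp⟩
  | add x y _ _ hx hy =>
    obtain ⟨hx, c, hc⟩ := hx
    obtain ⟨hy, d, hd⟩ := hy
    refine ⟨?_, c + d, by rw [map_add, hc, hd, add_smul]⟩
    rw [map_add, add_sub_add_comm]
    exact add_mem hx hy
  | smul a x _ hx =>
    obtain ⟨hx, c, hc⟩ := hx
    refine ⟨?_, a * c, by rw [map_smul, hc, mul_smul]⟩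
    rw [map_smul, ← smul_sub]
    exact (gnDer k n).smul_mem a hx
  | lie x y hx hy _ _ =>
    refine ⟨?_, 0, by rw [avg_lie, zero_smul]⟩
    rw [avg_lie, sub_zero]
    exact lie_mem_gnDer k n hx hy

end helpers

/-- Let `p : k[S_n] → k[S_n]` be the projection on the center,
`p(x) = (1/n!) ∑_{s ∈ S_n} s x s⁻¹`.  Then `p` maps `g_n` into itself, its image
`p(g_n)` is `k·T_n`, and the derived subalgebra `g'_n` is the kernel of the
restriction of `p` to `g_n`. -/
theorem center_projection (k : Type) [Field k] [CharZero k] (n : ℕ) (hn : 3 ≤ n)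
    (p : MonoidAlgebra k (Equiv.Perm (Fin n)) → MonoidAlgebra k (Equiv.Perm (Fin n)))
    (hp : ∀ x, p x = (n.factorial : k)⁻¹ •
      ∑ s : Equiv.Perm (Fin n),
        MonoidAlgebra.of k (Equiv.Perm (Fin n)) s * x *
          MonoidAlgebra.of k (Equiv.Perm (Fin n)) s⁻¹) :
    (∀ x ∈ gn k n, p x ∈ gn k n) ∧
    p '' (gn k n) = {x | ∃ c : k, x = c • sumTranspositions k n} ∧
    (∀ x, x ∈ gnDer k n ↔ x ∈ gn k n ∧ p x = 0) := by
  obtain rfl : p = avg k n := funext fun x => by rw [hp, avg_apply]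
  refine ⟨fun x hx => ?_, ?_, fun x => ⟨fun hx => gnDer_le k n hx, fun hx => ?_⟩⟩
  · obtain ⟨-, c, hc⟩ := gn_main k n hx
    rw [hc]
    exact (gn k n).smul_mem c (T_mem k n)
  · ext x
    constructor
    · rintro ⟨y, hy, rfl⟩
      exact (gn_main k n hy).2
    · rintro ⟨c, rfl⟩
      exact ⟨c • sumTranspositions k n, (gn k n).smul_mem c (T_mem k n),
        by rw [map_smul, avg_T]⟩
  · have := (gn_main k n hx.1).1
    rwa [hx.2, sub_zero] at this
end

section
/- For every partition λ, at most one partition μ with μ ↗ λ is both proper (not a hook) and symmetric (μ = μ'). -/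
/-- A partition: a weakly decreasing sequence of naturals, almost all zero.
`l i` is the length of row `i + 1` (rows are 0-indexed, so `l i = λ_{i+1}`). -/
def IsPart (l : ℕ → ℕ) : Prop :=
  (∀ i, l (i + 1) ≤ l i) ∧ ∃ N, ∀ i, N ≤ i → l i = 0

/-- The set of cells `(row, column)` (0-indexed) of the Young diagram of `l`. -/
def pcells (l : ℕ → ℕ) : Set (ℕ × ℕ) := {p | p.2 < l p.1}

/-- The size `|λ|` of the partition (number of cells of its Young diagram). -/
noncomputable def psize (l : ℕ → ℕ) : ℕ := Nat.card (pcells l)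

/-- The conjugate (transposed) partition `λ'`: `pconj l j = #{i : λ_{i+1} ≥ j+1}`. -/
noncomputable def pconj (l : ℕ → ℕ) : ℕ → ℕ := fun j => Nat.card {i : ℕ | j < l i}

/-- `μ ↗ λ` : `μ_i ≤ λ_i` for all `i` and `|μ| = |λ| - 1`. -/
def PCovers (m l : ℕ → ℕ) : Prop := (∀ i, m i ≤ l i) ∧ psize m + 1 = psize l

/-- `b(λ)`, the length of the diagonal of `λ` (number of `i ≥ 1` with `λ_i ≥ i`). -/
noncomputable def pdiag (l : ℕ → ℕ) : ℕ := Nat.card {i : ℕ | i < l i}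

/-- `δ(λ)`, the number of descents (removable corners) of `λ`. -/
noncomputable def pdelta (l : ℕ → ℕ) : ℕ := Nat.card {r : ℕ | l (r + 1) < l r}

/-- `λ^{(r)}` for the descent at 0-indexed row `r`: decrease that row by one. -/
def premove (l : ℕ → ℕ) (r : ℕ) : ℕ → ℕ := Function.update l r (l r - 1)

theorem aux_anti {l : ℕ → ℕ} (hl : IsPart l) : Antitone l := antitone_nat_of_succ_le hl.1

theorem aux_fin {l : ℕ → ℕ} (hl : IsPart l) : (pcells l).Finite := by
  obtain ⟨N, hN⟩ := hl.2
  refine ((Set.finite_Iio N).prod (Set.finite_Iio (l 0))).subset ?_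
  rintro ⟨i, j⟩ h
  have h' : j < l i := h
  have h0 := aux_anti hl (Nat.zero_le i)
  refine ⟨?_, ?_⟩
  · by_contra hc
    have := hN i (by simpa using hc)
    omega
  · show j < l 0
    omega

theorem aux_conj {m : ℕ → ℕ} (hm : IsPart m) (i j : ℕ) : i < pconj m j ↔ j < m i := by
  have hf : {i : ℕ | j < m i}.Finite := by
    obtain ⟨N, hN⟩ := hm.2
    refine (Set.finite_Iio N).subset ?_
    intro k hk
    have hk' : j < m k := hk
    by_contra hc
    have := hN k (by simpa using hc)
    omega
  have hd : pconj m j = {i : ℕ | j < m i}.ncard := rfl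
  rw [hd]
  constructor
  · intro h
    by_contra hc
    have hsub : {i : ℕ | j < m i} ⊆ (Finset.range i : Set ℕ) := by
      intro k hk
      have hk' : j < m k := hk
      by_contra hki
      have := aux_anti hm (show i ≤ k by simpa using hki)
      omega
    have := Set.ncard_le_ncard hsub (Finset.finite_toSet _)
    rw [Set.ncard_coe_finset, Finset.card_range] at this
    omega
  · intro h
    have hsub : (Finset.range (i+1) : Set ℕ) ⊆ {i : ℕ | j < m i} := by
      intro k hk
      have hk' : k < i + 1 := by simpa using hk
      have := aux_anti hm (show k ≤ i by omega)
      show j < m k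
      omega
    have := Set.ncard_le_ncard hsub hf
    rw [Set.ncard_coe_finset, Finset.card_range] at this
    omega

theorem aux_cover {l m : ℕ → ℕ} (hl : IsPart l) (hc : PCovers m l) :
    ∃ a b, ¬ b < m a ∧ b < l a ∧ ∀ i j, j < l i → j < m i ∨ (i = a ∧ j = b) := by
  have hsub : pcells m ⊆ pcells l := fun p hp => lt_of_lt_of_le hp (hc.1 p.1)
  have h1 : (pcells m).ncard + 1 = (pcells l).ncard := hc.2
  have h2 := Set.ncard_sdiff_add_ncard_of_subset hsub (aux_fin hl)
  have h3 : (pcells l \ pcells m).ncard = 1 := by omega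
  obtain ⟨⟨a, b⟩, h⟩ := Set.ncard_eq_one.1 h3
  have hab : (a, b) ∈ pcells l \ pcells m := by rw [h]; rfl
  refine ⟨a, b, hab.2, hab.1, fun i j hij => ?_⟩
  by_cases hm : j < m i
  · exact Or.inl hm
  · have : (i, j) ∈ pcells l \ pcells m := ⟨hij, hm⟩
    rw [h] at this
    right
    simpa using this

theorem at_most_one_proper_symmetric_cover (l : ℕ → ℕ) (hl : IsPart l)
    (m₁ m₂ : ℕ → ℕ) (hm₁ : IsPart m₁) (hm₂ : IsPart m₂)
    (hc₁ : PCovers m₁ l) (hc₂ : PCovers m₂ l)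
    (hp₁ : 2 ≤ pdiag m₁) (hp₂ : 2 ≤ pdiag m₂)
    (hs₁ : pconj m₁ = m₁) (hs₂ : pconj m₂ = m₂) :
    m₁ = m₂ := by
  have s1 := aux_conj hm₁
  have s2 := aux_conj hm₂
  rw [hs₁] at s1
  rw [hs₂] at s2
  obtain ⟨a, b, n1, l1, e1⟩ := aux_cover hl hc₁
  obtain ⟨c, d, n2, l2, e2⟩ := aux_cover hl hc₂
  have k1 : ∀ i j, j < m₁ i → j < l i := fun i j h => lt_of_lt_of_le h (hc₁.1 i)
  have k2 : ∀ i j, j < m₂ i → j < l i := fun i j h => lt_of_lt_of_le h (hc₂.1 i)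
  have key : ∀ i j, j < m₁ i ↔ j < m₂ i := by
    by_cases hE : a = c ∧ b = d
    · obtain ⟨rfl, rfl⟩ := hE
      intro i j
      constructor
      · intro h
        rcases e2 i j (k1 i j h) with h' | ⟨rfl, rfl⟩
        · exact h'
        · exact absurd h n1
      · intro h
        rcases e1 i j (k2 i j h) with h' | ⟨rfl, rfl⟩
        · exact h'
        · exact absurd h n2
    · exfalso
      have q1 : d < m₁ c := (e1 c d l2).resolve_right (fun h => hE ⟨h.1.symm, h.2.symm⟩)
      have q2 : b < m₂ a := (e2 a b l1).resolve_right hE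
      have r1 : c = d := by
        rcases e2 d c (k1 d c ((s1 c d).2 q1)) with h | h
        · exact absurd ((s2 d c).2 h) n2
        · exact h.2
      have r2 : a = b := by
        rcases e1 b a (k2 b a ((s2 a b).2 q2)) with h | h
        · exact absurd ((s1 b a).2 h) n1
        · exact h.2
      subst r1 r2
      rcases le_total a c with h | h
      · have := aux_anti hm₁ h
        omega
      · have := aux_anti hm₂ h
        omega
  funext i
  have x := key i (m₁ i)
  have y := key i (m₂ i)
  omega
end
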